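/- Let g* : ℝ^m → ℝ ∪ {+∞} be proper closed convex, M2 ∈ ℝ^{m×m} symmetric positive definite, and fix x^k, x^{k+1} ∈ ℝ^n, z^k ∈ ℝ^m. Consider the subproblem minimize_z h1(z) + h2(z) with h1(z) = g*(z) and h2(z) = ½‖z − z^k − M2^{-1}A(2x^{k+1} − x^k)‖²_{M2}. Let γ ∈ (0, 2λ_min(M2)/λ_max(M2)²) and define the proximal-gradient iterates z^{k+1}_0 = z^k, z^{k+1}_{i+1} = prox_{γ h1}(z^{k+1}_i − γ ∇h2(z^{k+1}_i)) for i = 0,…,p−1, with p ≥ 1. Then z^{k+1} = z^{k+1}_p satisfies 0 ∈ ∂g*(z^{k+1}) + M2( z^{k+1} − z^k − M2^{-1} A(2x^{k+1} − x^k) ) + ε^{k+1} for some ε^{k+1} with ‖ε^{k+1}‖ ≤ c(p) ‖z^{k+1} − z^k‖, where c(p) = ((1/γ) + λ_max(M2)) (τ^p + τ^{p−1}) / (1 − τ^p) and τ = sqrt(1 − γ(2λ_min(M2) − γ λ_max(M2)²)) < 1. -/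

import Mathlib

open Matrix Filter

noncomputable section

/-- Euclidean norm of a vector. -/
def nrm {ι : Type*} [Fintype ι] (x : ι → ℝ) : ℝ := Real.sqrt (x ⬝ᵥ x)

/-- A function into the extended reals is proper: never `⊥` and somewhere finite. -/
def ProperE {ι : Type*} (f : (ι → ℝ) → EReal) : Prop :=
  (∃ x, f x ≠ ⊤) ∧ ∀ x, f x ≠ ⊥

/-- Convexity of an extended-real-valued function. -/
def ConvexE {ι : Type*} (f : (ι → ℝ) → EReal) : Prop :=
  ∀ x y : ι → ℝ, ∀ t : ℝ, 0 ≤ t → t ≤ 1 →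
    f (t • x + (1 - t) • y) ≤ (t : EReal) * f x + ((1 - t : ℝ) : EReal) * f y

/-- `μ`-strong convexity of an extended-real-valued function. -/
def StrongConvexE {ι : Type*} [Fintype ι] (μ : ℝ) (f : (ι → ℝ) → EReal) : Prop :=
  ∀ x y : ι → ℝ, ∀ t : ℝ, 0 ≤ t → t ≤ 1 →
    f (t • x + (1 - t) • y) + ((μ / 2 * (t * (1 - t)) * ((x - y) ⬝ᵥ (x - y)) : ℝ) : EReal) ≤
      (t : EReal) * f x + ((1 - t : ℝ) : EReal) * f y

/-- Fenchel conjugate. -/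
def conjE {ι : Type*} [Fintype ι] (f : (ι → ℝ) → EReal) (y : ι → ℝ) : EReal :=
  ⨆ x : ι → ℝ, ((x ⬝ᵥ y : ℝ) : EReal) - f x

/-- `v` is a subgradient of `f` at `x`. -/
def SubgradAt {ι : Type*} [Fintype ι] (f : (ι → ℝ) → EReal) (x v : ι → ℝ) : Prop :=
  ∀ z, f x + (((z - x) ⬝ᵥ v : ℝ) : EReal) ≤ f z

/-- `p = prox^M_φ(x)`: `p` minimizes `φ(·) + ½‖· − x‖²_M`. -/
def IsProxPt {ι : Type*} [Fintype ι] (M : Matrix ι ι ℝ) (φ : (ι → ℝ) → EReal)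
    (x p : ι → ℝ) : Prop :=
  ∀ w, φ p + (((1 / 2 : ℝ) * ((p - x) ⬝ᵥ M.mulVec (p - x)) : ℝ) : EReal) ≤
       φ w + (((1 / 2 : ℝ) * ((w - x) ⬝ᵥ M.mulVec (w - x)) : ℝ) : EReal)

/-- Smallest eigenvalue of a symmetric matrix, via the Rayleigh quotient. -/
def lamMin {ι : Type*} [Fintype ι] (M : Matrix ι ι ℝ) : ℝ :=
  sInf {r | ∃ v : ι → ℝ, v ⬝ᵥ v = 1 ∧ r = v ⬝ᵥ M.mulVec v}

/-- Largest eigenvalue of a symmetric matrix, via the Rayleigh quotient. -/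
def lamMax {ι : Type*} [Fintype ι] (M : Matrix ι ι ℝ) : ℝ :=
  sSup {r | ∃ v : ι → ℝ, v ⬝ᵥ v = 1 ∧ r = v ⬝ᵥ M.mulVec v}

/-- Spectral (operator 2-) norm of a matrix. -/
def specNorm {ι κ : Type*} [Fintype ι] [Fintype κ] (A : Matrix ι κ ℝ) : ℝ :=
  sSup {r | ∃ v : κ → ℝ, v ⬝ᵥ v = 1 ∧ r = nrm (A.mulVec v)}

lemma nrm_eq_norm_toLp {ι : Type*} [Fintype ι] (x : ι → ℝ) : nrm x = ‖WithLp.toLp 2 x‖ := by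
  rw [nrm, EuclideanSpace.norm_eq]
  congr 1
  simp [dotProduct, sq]

lemma dotProduct_self_nonneg_real {ι : Type*} [Fintype ι] (x : ι → ℝ) : 0 ≤ x ⬝ᵥ x :=
  Finset.sum_nonneg fun _ _ => mul_self_nonneg _

lemma nrm_nonneg {ι : Type*} [Fintype ι] (x : ι → ℝ) : 0 ≤ nrm x := Real.sqrt_nonneg _

lemma nrm_sq {ι : Type*} [Fintype ι] (x : ι → ℝ) : nrm x ^ 2 = x ⬝ᵥ x :=
  Real.sq_sqrt (dotProduct_self_nonneg_real x)

lemma nrm_sub_le {ι : Type*} [Fintype ι] (x y : ι → ℝ) : nrm (x - y) ≤ nrm x + nrm y := by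
  simp only [nrm_eq_norm_toLp, WithLp.toLp_sub]
  exact norm_sub_le _ _

lemma nrm_smul {ι : Type*} [Fintype ι] (a : ℝ) (x : ι → ℝ) : nrm (a • x) = |a| * nrm x := by
  simp only [nrm_eq_norm_toLp, WithLp.toLp_smul, norm_smul, Real.norm_eq_abs]

lemma dotProduct_le_nrm_mul_nrm {ι : Type*} [Fintype ι] (x y : ι → ℝ) :
    x ⬝ᵥ y ≤ nrm x * nrm y := by
  have h := real_inner_le_norm (WithLp.toLp 2 y) (WithLp.toLp 2 x)
  rw [EuclideanSpace.inner_toLp_toLp, star_trivial] at h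
  rw [nrm_eq_norm_toLp, nrm_eq_norm_toLp, mul_comm]
  exact h

lemma conjE_ne_bot {ι : Type*} [Fintype ι] {g : (ι → ℝ) → EReal} (hg : ProperE g)
    (y : ι → ℝ) : conjE g y ≠ ⊥ := by
  obtain ⟨⟨x, hx⟩, hb⟩ := hg
  have h : ((x ⬝ᵥ y : ℝ) : EReal) - g x ≤ conjE g y :=
    le_iSup (fun x : ι → ℝ => ((x ⬝ᵥ y : ℝ) : EReal) - g x) x
  lift g x to ℝ using ⟨hx, hb x⟩ with r
  intro h0
  rw [h0, le_bot_iff, ← EReal.coe_sub] at h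
  exact EReal.coe_ne_bot _ h

lemma conjE_le_coe_iff {ι : Type*} [Fintype ι] {g : (ι → ℝ) → EReal} (hg : ProperE g)
    (y : ι → ℝ) (a : ℝ) :
    conjE g y ≤ a ↔ ∀ (x : ι → ℝ) (r : ℝ), g x = r → x ⬝ᵥ y - r ≤ a := by
  rw [conjE, iSup_le_iff]
  refine forall_congr' fun x => ?_
  rcases eq_or_ne (g x) ⊤ with h | h
  · simp [h]
  · lift g x to ℝ using ⟨h, hg.2 x⟩ with r
    rw [← EReal.coe_sub, EReal.coe_le_coe_iff]
    constructor
    · intro h1 s hs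
      rwa [← EReal.coe_injective hs]
    · intro h1
      exact h1 r rfl

lemma conjE_convex_combination_le {ι : Type*} [Fintype ι] {g : (ι → ℝ) → EReal}
    (hg : ProperE g) {y z : ι → ℝ} {a b t : ℝ} (ht0 : 0 ≤ t) (ht1 : t ≤ 1)
    (hy : conjE g y ≤ a) (hz : conjE g z ≤ b) :
    conjE g (y + t • (z - y)) ≤ ((a + t * (b - a) : ℝ) : EReal) := by
  rw [conjE_le_coe_iff hg] at *
  intro x r hr
  have h1 := hy x r hr
  have h2 := hz x r hr
  simp only [dotProduct_add, dotProduct_smul, dotProduct_sub, smul_eq_mul]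
  nlinarith

lemma lowerSemicontinuous_conjE {ι : Type*} [Fintype ι] {g : (ι → ℝ) → EReal}
    (hg : ProperE g) : LowerSemicontinuous (conjE g) := by
  have h : ∀ x : ι → ℝ,
      LowerSemicontinuous fun y : ι → ℝ => ((x ⬝ᵥ y : ℝ) : EReal) - g x := by
    intro x
    apply Continuous.lowerSemicontinuous
    rcases eq_or_ne (g x) ⊤ with h | h
    · simp only [h, EReal.sub_top]
      exact continuous_const
    · lift g x to ℝ using ⟨h, hg.2 x⟩ with r
      simp only [← EReal.coe_sub]
      exact continuous_coe_real_ereal.comp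
        ((Continuous.dotProduct continuous_const continuous_id).sub continuous_const)
  exact lowerSemicontinuous_iSup h

lemma nonneg_of_forall_mul_add_sq_mul {a b : ℝ}
    (h : ∀ t : ℝ, 0 < t → t ≤ 1 → 0 ≤ t * a + t ^ 2 * b) : 0 ≤ a := by
  by_contra! ha
  have hs : 0 < |b| - a := by linarith [abs_nonneg b]
  have h1 := h (-a / (2 * (|b| - a))) (by apply div_pos <;> linarith)
    (by rw [div_le_one (by linarith)]; linarith [abs_nonneg b])
  set t := -a / (2 * (|b| - a)) with ht
  have ht0 : 0 < t := by apply div_pos <;> linarith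
  have h2 : t * (2 * (|b| - a)) = -a := div_mul_cancel₀ _ (by linarith)
  have h3 : 0 ≤ a + t * b := by
    refine le_of_mul_le_mul_left (a := t) ?_ ht0
    linarith
  nlinarith [mul_le_mul_of_nonneg_left (le_abs_self b) ht0.le, mul_pos ht0 (neg_pos.2 ha)]

lemma IsProxPt.ne_top {ι : Type*} [Fintype ι] {M : Matrix ι ι ℝ} {φ : (ι → ℝ) → EReal}
    {x p y : ι → ℝ} (h : IsProxPt M φ x p) (hy : φ y ≠ ⊤) : φ p ≠ ⊤ := by
  intro hp
  have h1 := h y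
  rw [hp, EReal.top_add_coe, top_le_iff] at h1
  exact (EReal.add_lt_top hy (EReal.coe_ne_top _)).ne h1

lemma IsProxPt.subgradAt_conjE {ι : Type*} [Fintype ι] {M : Matrix ι ι ℝ}
    (hM : M.IsSymm) {g : (ι → ℝ) → EReal} (hg : ProperE g) {x p : ι → ℝ}
    (h : IsProxPt M (conjE g) x p) :
    SubgradAt (conjE g) p (-(M.mulVec (p - x))) := by
  intro z
  rcases eq_or_ne (conjE g z) ⊤ with hz | hz
  · rw [hz]; exact le_top
  have hp := h.ne_top hz
  have hpa := EReal.coe_toReal hp (conjE_ne_bot hg p)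
  have hzb := EReal.coe_toReal hz (conjE_ne_bot hg z)
  set a := (conjE g p).toReal
  set b := (conjE g z).toReal
  rw [← hpa, ← hzb, ← EReal.coe_add, EReal.coe_le_coe_iff]
  have key : 0 ≤ (b - a) + (z - p) ⬝ᵥ M.mulVec (p - x) := by
    apply nonneg_of_forall_mul_add_sq_mul
      (b := 1 / 2 * ((z - p) ⬝ᵥ M.mulVec (z - p)))
    intro t ht0 ht1
    have h1 := (h (p + t • (z - p))).trans
      (add_le_add_left (conjE_convex_combination_le hg ht0.le ht1 hpa.ge hzb.ge) _)
    rw [← hpa, ← EReal.coe_add, ← EReal.coe_add, EReal.coe_le_coe_iff] at h1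
    have h2 : p + t • (z - p) - x = (p - x) + t • (z - p) := by abel
    have h3 : (p - x) ⬝ᵥ M.mulVec (z - p) = (z - p) ⬝ᵥ M.mulVec (p - x) := by
      rw [dotProduct_mulVec, ← mulVec_transpose, hM.eq, dotProduct_comm]
    rw [h2] at h1
    generalize p - x = u at *
    generalize z - p = v at *
    simp only [mulVec_add, mulVec_smul, dotProduct_add, add_dotProduct, dotProduct_smul,
      smul_dotProduct, smul_eq_mul, h3] at h1
    linarith
  rw [dotProduct_neg]
  linarith

lemma SubgradAt.monotone {ι : Type*} [Fintype ι] {φ : (ι → ℝ) → EReal}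
    {p q u v : ι → ℝ} (hp : SubgradAt φ p u) (hq : SubgradAt φ q v)
    (hpt : φ p ≠ ⊤) (hpb : φ p ≠ ⊥) (hqt : φ q ≠ ⊤) (hqb : φ q ≠ ⊥) :
    0 ≤ (p - q) ⬝ᵥ (u - v) := by
  have h1 := hp q
  have h2 := hq p
  lift φ p to ℝ using ⟨hpt, hpb⟩ with a
  lift φ q to ℝ using ⟨hqt, hqb⟩ with b
  rw [← EReal.coe_add, EReal.coe_le_coe_iff] at h1 h2
  simp only [sub_dotProduct, dotProduct_sub] at *
  linarith

lemma exists_isProxPt_conjE {ι : Type*} [Fintype ι] {M : Matrix ι ι ℝ} {l : ℝ} (hl : 0 < l)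
    (hM : ∀ v : ι → ℝ, l * (v ⬝ᵥ v) ≤ v ⬝ᵥ M.mulVec v)
    {g : (ι → ℝ) → EReal} (hg : ProperE g) {y : ι → ℝ} (hy : conjE g y ≠ ⊤) (x : ι → ℝ) :
    ∃ p, IsProxPt M (conjE g) x p := by
  set q : (ι → ℝ) → ℝ := fun z => (1 / 2 : ℝ) * ((z - x) ⬝ᵥ M.mulVec (z - x)) with hq
  have hqc : Continuous q := by
    have h1 : Continuous fun z : ι → ℝ => z - x := continuous_id.sub continuous_const
    exact continuous_const.mul
      (h1.dotProduct (Continuous.matrix_mulVec continuous_const h1))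
  set F : (ι → ℝ) → EReal := fun z => conjE g z + (q z : EReal) with hF
  have hFc : LowerSemicontinuous F := by
    apply (lowerSemicontinuous_conjE hg).add'
      (continuous_coe_real_ereal.comp hqc).lowerSemicontinuous
    intro z
    exact EReal.continuousAt_add (Or.inr (EReal.coe_ne_bot _)) (Or.inr (EReal.coe_ne_top _))
  obtain ⟨⟨x0, hx0⟩, hb⟩ := id hg
  have hr := EReal.coe_toReal hx0 (hb x0)
  set r := (g x0).toReal
  have hya := EReal.coe_toReal hy (conjE_ne_bot hg y)
  set a := (conjE g y).toReal
  set K : Set (ι → ℝ) := F ⁻¹' Set.Iic (F y) with hK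
  have hKc : IsClosed K := hFc.isClosed_preimage _
  have hKb : Bornology.IsBounded K := by
    set C : ℝ := a + q y + r - x0 ⬝ᵥ x with hC
    set R : ℝ := 4 / l * (C + (x0 ⬝ᵥ x0) / l) with hR
    refine (Metric.isBounded_closedBall (x := x) (r := √R)).subset fun z hz => ?_
    have hz1 : F z ≤ ((a + q y : ℝ) : EReal) := by
      rw [EReal.coe_add, hya]; exact hz
    have hz2 : conjE g z ≤ ((a + q y - q z : ℝ) : EReal) := by
      rw [EReal.coe_sub]
      exact EReal.le_sub_iff_add_le (Or.inl (EReal.coe_ne_bot _))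
        (Or.inl (EReal.coe_ne_top _)) |>.2 hz1
    have hz3 := (conjE_le_coe_iff hg _ _).1 hz2 x0 r hr.symm
    have h4 : q z = 1 / 2 * ((z - x) ⬝ᵥ M.mulVec (z - x)) := rfl
    have h5 := hM (z - x)
    have h6 : x0 ⬝ᵥ z = x0 ⬝ᵥ x + x0 ⬝ᵥ (z - x) := by rw [dotProduct_sub]; ring
    have h7 := dotProduct_self_nonneg_real (l • (z - x) + (2 : ℝ) • x0)
    have h8 : (l • (z - x) + (2 : ℝ) • x0) ⬝ᵥ (l • (z - x) + (2 : ℝ) • x0)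
        = l ^ 2 * ((z - x) ⬝ᵥ (z - x)) + 4 * l * (x0 ⬝ᵥ (z - x)) + 4 * (x0 ⬝ᵥ x0) := by
      rw [add_dotProduct, dotProduct_add, dotProduct_add]
      simp only [dotProduct_smul, smul_dotProduct, smul_eq_mul, dotProduct_comm (z - x) x0]
      ring
    have h9 : (z - x) ⬝ᵥ (z - x) ≤ R := by
      have e : R = 4 * (C * l + x0 ⬝ᵥ x0) / l ^ 2 := by rw [hR]; field_simp
      rw [e, le_div_iff₀ (by positivity)]
      nlinarith
    rw [Metric.mem_closedBall, dist_pi_le_iff (Real.sqrt_nonneg _)]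
    intro i
    rw [Real.dist_eq]
    apply Real.abs_le_sqrt
    refine le_trans ?_ h9
    have := Finset.single_le_sum (f := fun i => (z - x) i * (z - x) i)
      (fun j _ => mul_self_nonneg _) (Finset.mem_univ i)
    simpa [dotProduct, sq] using this
  obtain ⟨p, hpK, hp⟩ := (hFc.lowerSemicontinuousOn K).exists_isMinOn
    ⟨y, le_refl (F y)⟩ (Metric.isCompact_of_isClosed_isBounded hKc hKb)
  refine ⟨p, fun z => ?_⟩
  change F p ≤ F z
  by_cases hz : z ∈ K
  · exact hp hz
  · exact (show F p ≤ F y from hpK).trans (not_le.1 hz).le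

lemma abs_dotProduct_mulVec_le_of_unit {ι : Type*} [Fintype ι] (M : Matrix ι ι ℝ)
    {v : ι → ℝ} (hv : v ⬝ᵥ v = 1) : |v ⬝ᵥ M.mulVec v| ≤ ∑ i, ∑ j, |M i j| := by
  have hc : ∀ i, |v i| ≤ 1 := by
    intro i
    have := Finset.single_le_sum (f := fun i => v i * v i)
      (fun j _ => mul_self_nonneg _) (Finset.mem_univ i)
    rw [← sq_le_one_iff_abs_le_one, sq]
    exact this.trans hv.le
  simp only [dotProduct, mulVec, Finset.mul_sum]
  refine (Finset.abs_sum_le_sum_abs _ _).trans (Finset.sum_le_sum fun i _ => ?_)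
  refine (Finset.abs_sum_le_sum_abs _ _).trans (Finset.sum_le_sum fun j _ => ?_)
  rw [abs_mul, abs_mul]
  calc |v i| * (|M i j| * |v j|) ≤ 1 * (|M i j| * 1) := by
        gcongr
        · exact hc i
        · exact hc j
    _ = |M i j| := by ring

lemma exists_unit_smul {ι : Type*} [Fintype ι] {v : ι → ℝ} (hv : v ≠ 0) :
    ∃ u : ι → ℝ, u ⬝ᵥ u = 1 ∧ v = nrm v • u := by
  have h : nrm v ≠ 0 := by
    intro h
    have := nrm_sq v
    rw [h] at this
    exact hv (dotProduct_self_eq_zero.1 (by simpa using this.symm))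
  refine ⟨(nrm v)⁻¹ • v, ?_, by rw [smul_smul, mul_inv_cancel₀ h, one_smul]⟩
  rw [dotProduct_smul, smul_dotProduct, ← nrm_sq]
  simp only [smul_eq_mul]
  field_simp

lemma lamMin_mul_le {ι : Type*} [Fintype ι] (M : Matrix ι ι ℝ) (v : ι → ℝ) :
    lamMin M * (v ⬝ᵥ v) ≤ v ⬝ᵥ M.mulVec v := by
  rcases eq_or_ne v 0 with rfl | hv
  · simp
  obtain ⟨u, hu, huv⟩ := exists_unit_smul hv
  have h : lamMin M ≤ u ⬝ᵥ M.mulVec u := by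
    refine csInf_le ⟨-∑ i, ∑ j, |M i j|, ?_⟩ ⟨u, hu, rfl⟩
    rintro _ ⟨w, hw, rfl⟩
    exact (abs_le.1 (abs_dotProduct_mulVec_le_of_unit M hw)).1
  rw [huv]
  simp only [mulVec_smul, dotProduct_smul, smul_dotProduct, smul_eq_mul, hu]
  nlinarith [sq_nonneg (nrm v)]

lemma le_lamMax_mul {ι : Type*} [Fintype ι] (M : Matrix ι ι ℝ) (v : ι → ℝ) :
    v ⬝ᵥ M.mulVec v ≤ lamMax M * (v ⬝ᵥ v) := by
  rcases eq_or_ne v 0 with rfl | hv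
  · simp
  obtain ⟨u, hu, huv⟩ := exists_unit_smul hv
  have h : u ⬝ᵥ M.mulVec u ≤ lamMax M := by
    refine le_csSup ⟨∑ i, ∑ j, |M i j|, ?_⟩ ⟨u, hu, rfl⟩
    rintro _ ⟨w, hw, rfl⟩
    exact (abs_le.1 (abs_dotProduct_mulVec_le_of_unit M hw)).2
  rw [huv]
  simp only [mulVec_smul, dotProduct_smul, smul_dotProduct, smul_eq_mul, hu]
  nlinarith [sq_nonneg (nrm v)]

lemma lamMin_le_lamMax {ι : Type*} [Fintype ι] (M : Matrix ι ι ℝ) (h : lamMax M ≠ 0) :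
    lamMin M ≤ lamMax M := by
  have hne : {r | ∃ v : ι → ℝ, v ⬝ᵥ v = 1 ∧ r = v ⬝ᵥ M.mulVec v}.Nonempty := by
    by_contra hne
    rw [Set.not_nonempty_iff_eq_empty] at hne
    exact h (by rw [lamMax, hne, Real.sSup_empty])
  obtain ⟨_, v, hv, -⟩ := hne
  have h1 := lamMin_mul_le M v
  have h2 := le_lamMax_mul M v
  rw [hv] at h1 h2
  linarith

lemma mulVec_dotProduct_mulVec_le {ι : Type*} [Fintype ι] {M : Matrix ι ι ℝ}
    (hM : M.IsSymm) (hpos : ∀ v : ι → ℝ, 0 ≤ v ⬝ᵥ M.mulVec v) (hl : 0 < lamMax M)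
    (v : ι → ℝ) : M.mulVec v ⬝ᵥ M.mulVec v ≤ lamMax M ^ 2 * (v ⬝ᵥ v) := by
  have h0 := hpos (lamMax M • v - M.mulVec v)
  have h1 := le_lamMax_mul M (M.mulVec v)
  have h2 := le_lamMax_mul M v
  have h3 : v ⬝ᵥ M.mulVec (M.mulVec v) = M.mulVec v ⬝ᵥ M.mulVec v := by
    rw [dotProduct_mulVec, ← mulVec_transpose, hM.eq]
  simp only [mulVec_sub, mulVec_smul, dotProduct_sub, sub_dotProduct, dotProduct_smul,
    smul_dotProduct, smul_eq_mul, h3] at h0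
  have h4 : lamMax M * (M.mulVec v ⬝ᵥ M.mulVec v)
      ≤ lamMax M * (lamMax M * (v ⬝ᵥ M.mulVec v)) := by linarith
  have h5 := le_of_mul_le_mul_left h4 hl
  nlinarith

lemma nrm_mulVec_le {ι : Type*} [Fintype ι] {M : Matrix ι ι ℝ}
    (hM : M.IsSymm) (hpos : ∀ v : ι → ℝ, 0 ≤ v ⬝ᵥ M.mulVec v) (hl : 0 < lamMax M)
    (v : ι → ℝ) : nrm (M.mulVec v) ≤ lamMax M * nrm v := by
  refine (sq_le_sq₀ (nrm_nonneg _) (mul_nonneg hl.le (nrm_nonneg v))).1 ?_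
  rw [mul_pow, nrm_sq, nrm_sq]
  exact mulVec_dotProduct_mulVec_le hM hpos hl v

/-- A gradient step on a strongly convex quadratic form is a contraction. -/
lemma nrm_sub_smul_mulVec_le {ι : Type*} [Fintype ι] {M : Matrix ι ι ℝ}
    (hM : M.IsSymm) (hpos : ∀ v : ι → ℝ, 0 ≤ v ⬝ᵥ M.mulVec v) (hl : 0 < lamMax M)
    {γ : ℝ} (hγ : 0 ≤ γ) (v : ι → ℝ) :
    nrm (v - γ • M.mulVec v) ≤
      √(1 - γ * (2 * lamMin M - γ * lamMax M ^ 2)) * nrm v := by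
  have h1 := lamMin_mul_le M v
  have h2 := mulVec_dotProduct_mulVec_le hM hpos hl v
  rw [nrm, nrm, ← Real.sqrt_mul' _ (dotProduct_self_nonneg_real v)]
  apply Real.sqrt_le_sqrt
  simp only [dotProduct_sub, sub_dotProduct, dotProduct_smul, smul_dotProduct, smul_eq_mul,
    dotProduct_comm (M.mulVec v) v]
  nlinarith [mul_le_mul_of_nonneg_left h1 hγ, mul_le_mul_of_nonneg_left h2 (mul_nonneg hγ hγ)]

/-- running `p ≥ 1` proximal-gradient steps with stepsize
`γ ∈ (0, 2λ_min(M2)/λ_max(M2)²)` on the `z`-subproblem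
`min_z g*(z) + ½‖z − z^k − M2⁻¹A(2x^{k+1}−x^k)‖²_{M2}` (starting from `z^k`) produces
`z^{k+1} = ζ_p` solving the subproblem to the bounded relative error
`0 ∈ ∂g*(z^{k+1}) + M2(z^{k+1} − z^k − M2⁻¹A(2x^{k+1}−x^k)) + ε`,
`‖ε‖ ≤ c(p)‖z^{k+1} − z^k‖`, with
`c(p) = (1/γ + λ_max(M2))(τ^p + τ^{p−1})/(1 − τ^p)` and
`τ = √(1 − γ(2λ_min(M2) − γλ_max(M2)²)) < 1`. -/
theorem prox_grad_bounded_relative_error {n m : ℕ}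
    (g : (Fin m → ℝ) → EReal)
    (hgp : ProperE g) (hgc : LowerSemicontinuous g) (hgv : ConvexE g)
    (M2 : Matrix (Fin m) (Fin m) ℝ) (hM2 : M2.PosDef)
    (A : Matrix (Fin m) (Fin n) ℝ)
    (xk xk1 : Fin n → ℝ) (zk : Fin m → ℝ)
    (w : Fin m → ℝ) (hw : w = zk + M2⁻¹.mulVec (A.mulVec ((2 : ℝ) • xk1 - xk)))
    (γ : ℝ) (hγ0 : 0 < γ) (hγ1 : γ < 2 * lamMin M2 / lamMax M2 ^ 2)
    (p : ℕ) (hp : 1 ≤ p)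
    (ζ : ℕ → Fin m → ℝ) (hζ0 : ζ 0 = zk)
    (hζ : ∀ i : ℕ, i < p →
      IsProxPt (γ⁻¹ • (1 : Matrix (Fin m) (Fin m) ℝ)) (conjE g)
        (ζ i - γ • M2.mulVec (ζ i - w)) (ζ (i + 1)))
    (τ : ℝ) (hτ : τ = Real.sqrt (1 - γ * (2 * lamMin M2 - γ * lamMax M2 ^ 2)))
    (c : ℝ) (hc : c = (1 / γ + lamMax M2) * (τ ^ p + τ ^ (p - 1)) / (1 - τ ^ p)) :
    τ < 1 ∧
      ∃ ε : Fin m → ℝ,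
        SubgradAt (conjE g) (ζ p) (-(M2.mulVec (ζ p - w)) - ε) ∧
        nrm ε ≤ c * nrm (ζ p - zk) := by
  have hL2 : 0 < lamMax M2 ^ 2 := by
    refine lt_of_le_of_ne (sq_nonneg _) fun h => ?_
    rw [← h, div_zero] at hγ1
    exact hγ0.not_gt hγ1
  have hL0 : lamMax M2 ≠ 0 := fun h => by simp [h] at hL2
  rw [lt_div_iff₀ hL2] at hγ1
  have hl : 0 < lamMin M2 := by nlinarith [mul_pos hγ0 hL2]
  have hL : 0 < lamMax M2 := hl.trans_le (lamMin_le_lamMax M2 hL0)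
  have hτ0 : 0 ≤ τ := hτ ▸ Real.sqrt_nonneg _
  have hτ1 : τ < 1 := by
    rw [hτ, Real.sqrt_lt' one_pos]
    nlinarith [mul_pos hγ0 (sub_pos.2 hγ1)]
  have hτp : τ ^ p < 1 := pow_lt_one₀ hτ0 hτ1 (by omega)
  refine ⟨hτ1, ?_⟩
  by_cases hdom : ∃ y, conjE g y ≠ ⊤
  · obtain ⟨y, hy⟩ := hdom
    have hsymm : M2.IsSymm := by simpa using hM2.1
    have hpos : ∀ v : Fin m → ℝ, 0 ≤ v ⬝ᵥ M2.mulVec v := fun v =>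
      (mul_nonneg hl.le (dotProduct_self_nonneg_real v)).trans (lamMin_mul_le M2 v)
    obtain ⟨z, hz⟩ := exists_isProxPt_conjE hl (lamMin_mul_le M2) hgp hy w
    have hzs := hz.subgradAt_conjE hsymm hgp
    have hstep : ∀ i < p, SubgradAt (conjE g) (ζ (i + 1))
        (γ⁻¹ • (ζ i - ζ (i + 1)) - M2.mulVec (ζ i - w)) := by
      intro i hi
      have h := (hζ i hi).subgradAt_conjE (by simp [Matrix.IsSymm]) hgp
      convert h using 1
      rw [smul_mulVec, one_mulVec, ← smul_neg, neg_sub, sub_right_comm, smul_sub _ _ (γ • _),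
        smul_smul, inv_mul_cancel₀ hγ0.ne', one_smul]
    have hcontr : ∀ i < p, nrm (ζ (i + 1) - z) ≤ τ * nrm (ζ i - z) := by
      intro i hi
      have h := (hstep i hi).monotone hzs ((hζ i hi).ne_top hy) (conjE_ne_bot hgp _)
        (hz.ne_top hy) (conjE_ne_bot hgp _)
      have e : γ⁻¹ • (ζ i - ζ (i + 1)) - M2.mulVec (ζ i - w) - -(M2.mulVec (z - w))
          = γ⁻¹ • ((ζ i - z) - γ • M2.mulVec (ζ i - z) - (ζ (i + 1) - z)) := by
        have e1 : ζ i - z = (ζ i - w) - (z - w) := by abel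
        have e2 : M2.mulVec (ζ i - z) = M2.mulVec (ζ i - w) - M2.mulVec (z - w) := by
          rw [e1, mulVec_sub]
        rw [e2]
        ext j
        simp only [Pi.sub_apply, Pi.smul_apply, Pi.neg_apply, smul_eq_mul]
        field_simp
        ring
      rw [e, dotProduct_smul, smul_eq_mul, mul_nonneg_iff_of_pos_left (inv_pos.2 hγ0),
        dotProduct_sub, ← nrm_sq] at h
      have h1 := nrm_sub_smul_mulVec_le hsymm hpos hL hγ0.le (ζ i - z)
      rw [← hτ] at h1
      have h2 := dotProduct_le_nrm_mul_nrm (ζ (i + 1) - z)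
        ((ζ i - z) - γ • M2.mulVec (ζ i - z))
      rcases (nrm_nonneg (ζ (i + 1) - z)).eq_or_lt with h0 | h0
      · rw [← h0]
        exact mul_nonneg hτ0 (nrm_nonneg _)
      · refine le_trans ?_ h1
        exact le_of_mul_le_mul_left (by linarith) h0
    have hpow : ∀ i ≤ p, nrm (ζ i - z) ≤ τ ^ i * nrm (zk - z) := by
      intro i
      induction i with
      | zero => simp [hζ0]
      | succ i ih =>
        intro hi
        calc nrm (ζ (i + 1) - z) ≤ τ * nrm (ζ i - z) := hcontr i hi
          _ ≤ τ * (τ ^ i * nrm (zk - z)) := by gcongr; exact ih (by omega)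
          _ = _ := by ring
    obtain ⟨k, rfl⟩ : ∃ k, p = k + 1 := ⟨p - 1, by omega⟩
    refine ⟨M2.mulVec (ζ k - ζ (k + 1)) - γ⁻¹ • (ζ k - ζ (k + 1)), ?_, ?_⟩
    · convert hstep k (by omega) using 1
      have e1 : ζ k - ζ (k + 1) = (ζ k - w) - (ζ (k + 1) - w) := by abel
      rw [show M2.mulVec (ζ k - ζ (k + 1)) = M2.mulVec (ζ k - w) - M2.mulVec (ζ (k + 1) - w) by
        rw [e1, mulVec_sub]]
      abel
    · set D := nrm (zk - z)
      have h1 : nrm (ζ k - ζ (k + 1)) ≤ (τ ^ (k + 1) + τ ^ k) * D := by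
        have h := nrm_sub_le (ζ k - z) (ζ (k + 1) - z)
        rw [sub_sub_sub_cancel_right] at h
        linarith [hpow k (by omega), hpow (k + 1) le_rfl]
      have h2 : D ≤ nrm (ζ (k + 1) - zk) / (1 - τ ^ (k + 1)) := by
        rw [le_div_iff₀ (by linarith)]
        have h := nrm_sub_le (ζ (k + 1) - z) (ζ (k + 1) - zk)
        rw [sub_sub_sub_cancel_left] at h
        linarith [hpow (k + 1) le_rfl]
      calc nrm (M2.mulVec (ζ k - ζ (k + 1)) - γ⁻¹ • (ζ k - ζ (k + 1)))
          ≤ nrm (M2.mulVec (ζ k - ζ (k + 1))) + nrm (γ⁻¹ • (ζ k - ζ (k + 1))) :=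
            nrm_sub_le _ _
        _ ≤ lamMax M2 * nrm (ζ k - ζ (k + 1)) + γ⁻¹ * nrm (ζ k - ζ (k + 1)) := by
            rw [nrm_smul, abs_of_pos (inv_pos.2 hγ0)]
            gcongr
            exact nrm_mulVec_le hsymm hpos hL _
        _ = (1 / γ + lamMax M2) * nrm (ζ k - ζ (k + 1)) := by ring
        _ ≤ (1 / γ + lamMax M2) * ((τ ^ (k + 1) + τ ^ k) *
              (nrm (ζ (k + 1) - zk) / (1 - τ ^ (k + 1)))) := by
            gcongr
            exact h1.trans (by gcongr)
        _ = c * nrm (ζ (k + 1) - zk) := by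
            rw [hc, Nat.add_sub_cancel]
            ring
  · push Not at hdom
    refine ⟨0, fun x => by rw [hdom x]; exact le_top, ?_⟩
    have h0 : nrm (0 : Fin m → ℝ) = 0 := by simp [nrm]
    have h1 : 0 < 1 - τ ^ p := by linarith
    rw [h0, hc]
    have := nrm_nonneg (ζ p - zk)
    positivity
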